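/- arXiv:math/9810041 — 7 statements merged into one kernel-verified Lean document; each statement's English description precedes it below -/
import Mathlib

section
/- Let R be an Artinian local ring with residue field k and let M be an R-module. Suppose there is a resolution ⋯ → N₁ → N₀ → M → 0 of M by flat R-modules Nᵢ such that the induced complex ⋯ → N₁ ⊗_R k → N₀ ⊗_R k → M ⊗_R k → 0 is still exact. Then M is a flat R-module. -/
open TensorProduct in
theorem aux_comm {R : Type*} [CommRing R] {A B P Q : Type*} [AddCommGroup A] [Module R A]
    [AddCommGroup B] [Module R B] [AddCommGroup P] [Module R P] [AddCommGroup Q] [Module R Q]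
    (f : P →ₗ[R] Q) (g : A →ₗ[R] B) (x : P ⊗[R] A) :
    f.rTensor B (g.lTensor P x) = g.lTensor Q (f.rTensor A x) := by
  rw [← LinearMap.comp_apply, ← LinearMap.comp_apply, LinearMap.rTensor_comp_lTensor,
    LinearMap.lTensor_comp_rTensor]

theorem aux_ext {R : Type*} [CommRing R] {P Q S A B C : Type*}
    [AddCommGroup P] [Module R P] [AddCommGroup Q] [Module R Q] [AddCommGroup S] [Module R S]
    [AddCommGroup A] [Module R A] [AddCommGroup B] [Module R B] [AddCommGroup C] [Module R C]
    [Module.Flat R S] (e : P →ₗ[R] Q) (f : Q →ₗ[R] S) (hef : Function.Exact e f)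
    (i : A →ₗ[R] B) (p : B →ₗ[R] C) (hi : Function.Injective i) (hp : Function.Surjective p)
    (hip : Function.Exact i p)
    (hA : Function.Exact (e.rTensor A) (f.rTensor A))
    (hC : Function.Exact (e.rTensor C) (f.rTensor C)) :
    Function.Exact (e.rTensor B) (f.rTensor B) := by
  intro x
  constructor
  · intro hx
    obtain ⟨y, hy⟩ := (hC (p.lTensor Q x)).1 (by rw [aux_comm, hx, map_zero])
    obtain ⟨y, rfl⟩ := LinearMap.lTensor_surjective P hp y
    obtain ⟨a, ha⟩ := (lTensor_exact Q hip hp (x - e.rTensor B y)).1 (by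
      rw [map_sub, ← aux_comm, hy, sub_self])
    have h0 : f.rTensor B (e.rTensor B y) = 0 := by
      rw [← LinearMap.comp_apply, ← LinearMap.rTensor_comp, hef.linearMap_comp_eq_zero]
      simp
    obtain ⟨a', rfl⟩ := (hA a).1 (by
      apply Module.Flat.lTensor_preserves_injective_linearMap (M := S) i hi
      rw [← aux_comm, ha, map_sub, hx, h0, sub_self, map_zero])
    refine ⟨i.lTensor P a' + y, ?_⟩
    rw [map_add, aux_comm, ha, sub_add_cancel]
  · rintro ⟨y, rfl⟩
    rw [← LinearMap.comp_apply, ← LinearMap.rTensor_comp, hef.linearMap_comp_eq_zero]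
    simp

theorem aux_equiv {R : Type*} [CommRing R] {P Q S A B : Type*}
    [AddCommGroup P] [Module R P] [AddCommGroup Q] [Module R Q] [AddCommGroup S] [Module R S]
    [AddCommGroup A] [Module R A] [AddCommGroup B] [Module R B]
    [Module.Flat R S] (e : P →ₗ[R] Q) (f : Q →ₗ[R] S) (hef : Function.Exact e f)
    (i : A ≃ₗ[R] B)
    (hA : Function.Exact (e.rTensor A) (f.rTensor A)) :
    Function.Exact (e.rTensor B) (f.rTensor B) := by
  refine aux_ext e f hef i.toLinearMap (0 : B →ₗ[R] PUnit) i.injective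
    (fun x => ⟨0, rfl⟩) (fun x => ⟨fun _ => i.surjective x, fun _ => rfl⟩) hA ?_
  intro x
  exact ⟨fun _ => ⟨0, Subsingleton.elim _ _⟩, fun _ => Subsingleton.elim _ _⟩

theorem aux_len {R : Type*} [CommRing R] [IsLocalRing R] {P Q S : Type*}
    [AddCommGroup P] [Module R P] [AddCommGroup Q] [Module R Q] [AddCommGroup S] [Module R S]
    [Module.Flat R S] (e : P →ₗ[R] Q) (f : Q →ₗ[R] S) (hef : Function.Exact e f)
    (hk : Function.Exact (e.rTensor (IsLocalRing.ResidueField R))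
      (f.rTensor (IsLocalRing.ResidueField R)))
    {X : Type*} [AddCommGroup X] [Module R X] (hX : IsFiniteLength R X) :
    Function.Exact (e.rTensor X) (f.rTensor X) := by
  induction hX with
  | of_subsingleton =>
    intro x
    exact ⟨fun _ => ⟨0, Subsingleton.elim _ _⟩, fun _ => Subsingleton.elim _ _⟩
  | @of_simple_quotient X _ _ N hs hN ih =>
    refine aux_ext e f hef N.subtype N.mkQ N.injective_subtype N.mkQ_surjective
      (LinearMap.exact_subtype_mkQ N) ih ?_
    obtain ⟨I, hI, ⟨g⟩⟩ := isSimpleModule_iff_quot_maximal.1 hs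
    obtain rfl := IsLocalRing.eq_maximalIdeal hI
    exact aux_equiv e f hef g.symm hk

/-- If an `R`-module `M` over an Artinian local ring admits a resolution by flat
modules that stays exact after tensoring with the residue field `k`, then `M` is flat. -/
theorem stmt_0 (R : Type*) [CommRing R] [IsArtinianRing R] [IsLocalRing R]
    (M : Type*) [AddCommGroup M] [Module R M]
    (N : ℕ → Type*) [∀ i, AddCommGroup (N i)] [∀ i, Module R (N i)]
    (hflat : ∀ i, Module.Flat R (N i))
    (d : ∀ i, N (i + 1) →ₗ[R] N i) (ε : N 0 →ₗ[R] M)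
    -- the complex `⋯ → N₁ → N₀ → M → 0` is exact
    (hsurj : Function.Surjective ε)
    (hex0 : Function.Exact (d 0) ε)
    (hex : ∀ i, Function.Exact (d (i + 1)) (d i))
    -- the complex `⋯ → N₁ ⊗ k → N₀ ⊗ k → M ⊗ k → 0` is exact
    (hksurj : Function.Surjective (LinearMap.rTensor (IsLocalRing.ResidueField R) ε))
    (hkex0 : Function.Exact (LinearMap.rTensor (IsLocalRing.ResidueField R) (d 0))
      (LinearMap.rTensor (IsLocalRing.ResidueField R) ε))
    (hkex : ∀ i, Function.Exact (LinearMap.rTensor (IsLocalRing.ResidueField R) (d (i + 1)))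
      (LinearMap.rTensor (IsLocalRing.ResidueField R) (d i))) :
    Module.Flat R M := by
  rw [Module.Flat.iff_lTensor_injective']
  intro I
  have hE : Function.Exact ((d 1).rTensor (R ⧸ I)) ((d 0).rTensor (R ⧸ I)) :=
    aux_len (d 1) (d 0) (hex 0) (hkex 0)
      (isFiniteLength_iff_isNoetherian_isArtinian.2 ⟨inferInstance, inferInstance⟩)
  have hI := LinearMap.exact_subtype_mkQ I
  rw [injective_iff_map_eq_zero]
  intro x hx
  obtain ⟨n0, rfl⟩ := LinearMap.rTensor_surjective I hsurj x
  rw [← aux_comm] at hx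
  obtain ⟨n1, hn1⟩ := (rTensor_exact R hex0 hsurj _).1 hx
  have hc : I.mkQ.lTensor (N 0) (I.subtype.lTensor (N 0) n0) = 0 :=
    (lTensor_exact (N 0) hI I.mkQ_surjective _).2 ⟨n0, rfl⟩
  obtain ⟨n2, hn2⟩ := (hE (I.mkQ.lTensor (N 1) n1)).1 (by
    rw [aux_comm]; exact (congrArg _ hn1).trans hc)
  obtain ⟨n2, rfl⟩ := LinearMap.lTensor_surjective (N 2) I.mkQ_surjective n2
  obtain ⟨n1', hn1'⟩ := (lTensor_exact (N 1) hI I.mkQ_surjective (n1 - (d 1).rTensor R n2)).1 (by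
    rw [map_sub, ← aux_comm]; exact sub_eq_zero.2 hn2.symm)
  have h0 : (d 0).rTensor R ((d 1).rTensor R n2) = 0 := by
    rw [← LinearMap.comp_apply, ← LinearMap.rTensor_comp, (hex 0).linearMap_comp_eq_zero]
    simp
  have key : (d 0).rTensor I n1' = n0 := by
    have := hflat 0
    apply Module.Flat.lTensor_preserves_injective_linearMap (M := N 0) I.subtype I.injective_subtype
    rw [← aux_comm]
    refine (congrArg _ hn1').trans ?_
    rw [map_sub, h0, sub_zero]
    exact hn1
  rw [← key]
  exact (rTensor_exact I hex0 hsurj _).2 ⟨n1', rfl⟩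
end

section
/- Let R be an Artinian local ring with residue field k and let M be an R-module. Suppose there is a resolution ⋯ → N₁ → N₀ → M → 0 of M by flat R-modules Nᵢ such that the induced complex ⋯ → N₁ ⊗_R k → N₀ ⊗_R k → M ⊗_R k → 0 is still exact. Then for every finitely generated R-module P, the induced complex ⋯ → N₁ ⊗_R P → N₀ ⊗_R P → M ⊗_R P → 0 is exact. -/
open TensorProduct in
theorem aux_ext_s1 {R A B C P Q S : Type} [CommRing R] [AddCommGroup A] [Module R A]
    [AddCommGroup B] [Module R B] [AddCommGroup C] [Module R C]
    [AddCommGroup P] [Module R P] [AddCommGroup Q] [Module R Q] [AddCommGroup S] [Module R S]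
    (hC : Module.Flat R C) (u : A →ₗ[R] B) (v : B →ₗ[R] C) (huv : Function.Exact u v)
    (f : P →ₗ[R] Q) (g : Q →ₗ[R] S) (hf : Function.Injective f) (hg : Function.Surjective g)
    (hfg : Function.Exact f g)
    (hP : Function.Exact (LinearMap.rTensor P u) (LinearMap.rTensor P v))
    (hS : Function.Exact (LinearMap.rTensor S u) (LinearMap.rTensor S v)) :
    Function.Exact (LinearMap.rTensor Q u) (LinearMap.rTensor Q v) := by
  have comm : ∀ {X Y Z W : Type} [AddCommGroup X] [Module R X] [AddCommGroup Y] [Module R Y]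
      [AddCommGroup Z] [Module R Z] [AddCommGroup W] [Module R W]
      (a : X →ₗ[R] Y) (b : Z →ₗ[R] W) (x : X ⊗[R] Z),
      LinearMap.rTensor W a (LinearMap.lTensor X b x)
        = LinearMap.lTensor Y b (LinearMap.rTensor Z a x) := by
    intro X Y Z W _ _ _ _ _ _ _ _ a b x
    rw [← LinearMap.comp_apply, ← LinearMap.comp_apply, LinearMap.rTensor_comp_lTensor,
      LinearMap.lTensor_comp_rTensor]
  have hz : ∀ y, LinearMap.rTensor Q v (LinearMap.rTensor Q u y) = 0 := by
    intro y
    rw [← LinearMap.comp_apply, ← LinearMap.rTensor_comp, huv.linearMap_comp_eq_zero]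
    simp
  intro x
  constructor
  · intro hx
    have h1 : LinearMap.rTensor S v (LinearMap.lTensor B g x) = 0 := by
      rw [comm, hx, map_zero]
    obtain ⟨y', hy'⟩ := (hS _).1 h1
    obtain ⟨y, rfl⟩ := LinearMap.lTensor_surjective A hg y'
    have h2 : LinearMap.lTensor B g (x - LinearMap.rTensor Q u y) = 0 := by
      rw [map_sub, ← comm, hy', sub_self]
    obtain ⟨z, hz'⟩ := (lTensor_exact B hfg hg _).1 h2
    have h3 : LinearMap.rTensor P v z = 0 := by
      apply Module.Flat.lTensor_preserves_injective_linearMap (M := C) f hf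
      rw [← comm, hz', map_sub, hx, hz, sub_self, map_zero]
    obtain ⟨w, rfl⟩ := (hP _).1 h3
    refine ⟨LinearMap.lTensor A f w + y, ?_⟩
    rw [map_add, comm, hz', sub_add_cancel]
  · rintro ⟨y, rfl⟩
    exact hz y

/-- If an `R`-module `M` over an Artinian local ring admits a resolution by flat
modules that stays exact after tensoring with the residue field `k`, then it stays exact after
tensoring with any finitely generated `R`-module `P`. -/
theorem stmt_1 (R : Type) [CommRing R] [IsArtinianRing R] [IsLocalRing R]
    (M : Type) [AddCommGroup M] [Module R M]
    (N : ℕ → Type) [∀ i, AddCommGroup (N i)] [∀ i, Module R (N i)]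
    (hflat : ∀ i, Module.Flat R (N i))
    (d : ∀ i, N (i + 1) →ₗ[R] N i) (ε : N 0 →ₗ[R] M)
    -- the complex `⋯ → N₁ → N₀ → M → 0` is exact
    (hsurj : Function.Surjective ε)
    (hex0 : Function.Exact (d 0) ε)
    (hex : ∀ i, Function.Exact (d (i + 1)) (d i))
    -- the complex `⋯ → N₁ ⊗ k → N₀ ⊗ k → M ⊗ k → 0` is exact
    (hksurj : Function.Surjective (LinearMap.rTensor (IsLocalRing.ResidueField R) ε))
    (hkex0 : Function.Exact (LinearMap.rTensor (IsLocalRing.ResidueField R) (d 0))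
      (LinearMap.rTensor (IsLocalRing.ResidueField R) ε))
    (hkex : ∀ i, Function.Exact (LinearMap.rTensor (IsLocalRing.ResidueField R) (d (i + 1)))
      (LinearMap.rTensor (IsLocalRing.ResidueField R) (d i))) :
    ∀ (P : Type) [AddCommGroup P] [Module R P], Module.Finite R P →
      Function.Surjective (LinearMap.rTensor P ε) ∧
      Function.Exact (LinearMap.rTensor P (d 0)) (LinearMap.rTensor P ε) ∧
      ∀ i, Function.Exact (LinearMap.rTensor P (d (i + 1))) (LinearMap.rTensor P (d i)) := by
  intro P _ _ hP
  refine ⟨LinearMap.rTensor_surjective P hsurj, rTensor_exact P hex0 hsurj, fun i => ?_⟩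
  have hsub : ∀ (L : Type) [AddCommGroup L] [Module R L] [Subsingleton L],
      Function.Exact (LinearMap.rTensor L (d (i + 1))) (LinearMap.rTensor L (d i)) := by
    intro L _ _ _ x
    have h1 : Subsingleton (TensorProduct R (N (i + 1)) L) := inferInstance
    have h2 : Subsingleton (TensorProduct R (N i) L) := inferInstance
    exact ⟨fun _ => ⟨0, Subsingleton.elim _ _⟩, fun _ => Subsingleton.elim _ _⟩
  induction hP using IsNoetherianRing.induction_on_isQuotientEquivQuotientPrime R with
  | subsingleton L => exact hsub L
  | quotient L p e =>
    obtain ⟨p, hp⟩ := p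
    have hm : p = IsLocalRing.maximalIdeal R :=
      IsLocalRing.eq_maximalIdeal (IsArtinianRing.isMaximal_of_isPrime p)
    subst hm
    have e' : L ≃ₗ[R] IsLocalRing.ResidueField R := e
    refine aux_ext_s1 (hflat i) _ _ (hex i) (0 : PUnit →ₗ[R] L) e'.toLinearMap
      (Function.injective_of_subsingleton _) e'.surjective ?_ (hsub PUnit) (hkex i)
    intro x
    simp [@eq_comm _ (0 : L)]
  | exact N₁ N₂ N₃ f g hf hg hfg h₁ h₃ =>
    exact aux_ext_s1 (hflat i) _ _ (hex i) f g hf hg hfg h₁ h₃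
end

section
/- Let V be a finite-dimensional ℂ-vector space and Δ : V → V ⊗ V a cocommutative, coassociative ℂ-linear map with Δ^{(n)} = 0, and let R_Δ = ℂ × V* be the associated algebra with maximal ideal m = {0} × V*. Suppose given a filtration by subspaces 0 = V⁰ ⊆ V¹ ⊆ ⋯ ⊆ Vⁿ = V such that for every 1 ≤ i ≤ n, Δ(Vⁱ) is contained in the image of V^{i−1} ⊗ V^{i−1} in V ⊗ V. For i ≥ 1 set m_i = {f ∈ V* : f vanishes on V^{i−1}} (so m₁ = V* = m and m_{n+1} = 0). Then m · m_i ⊆ m_{i+1} for all 1 ≤ i ≤ n, each m_i is an ideal of R_Δ, and mⁱ ⊆ m_i for all i ≥ 1. -/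
open TensorProduct

/-- The multiplication on `R_Δ = ℂ × V*`:
`(a,f)·(b,g) = (ab, a·g + b·f + (f ⊗ g) ∘ Δ)`. -/
noncomputable def deltaMul {V : Type*} [AddCommGroup V] [Module ℂ V]
    (Δ : V →ₗ[ℂ] V ⊗[ℂ] V) (p q : ℂ × Module.Dual ℂ V) : ℂ × Module.Dual ℂ V :=
  (p.1 * q.1, p.1 • q.2 + q.1 • p.2 + (TensorProduct.dualDistrib ℂ V V (p.2 ⊗ₜ[ℂ] q.2)) ∘ₗ Δ)

/-- The iterated tensor powers `TP V k = V^{⊗(k+1)}` (right-nested), as objects of the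
category of `ℂ`-modules. -/
noncomputable def TP (V : Type) [AddCommGroup V] [Module ℂ V] : ℕ → ModuleCat ℂ
  | 0 => ModuleCat.of ℂ V
  | k + 1 => ModuleCat.of ℂ (V ⊗[ℂ] (TP V k))

/-- The iterated comultiplications `Δ^{(k)} : V → V^{⊗(k+1)}`, defined by `Δ^{(1)} = Δ` and
`Δ^{(k)} = (Δ ⊗ id_{V^{⊗(k−1)}}) ∘ Δ^{(k−1)}` (composed with the canonical associator). -/
noncomputable def iterDelta {V : Type} [AddCommGroup V] [Module ℂ V]
    (Δ : V →ₗ[ℂ] V ⊗[ℂ] V) : ∀ k : ℕ, V →ₗ[ℂ] TP V k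
  | 0 => LinearMap.id
  | 1 => Δ
  | (k + 2) =>
      (TensorProduct.assoc ℂ V V (TP V k)).toLinearMap
        ∘ₗ (LinearMap.rTensor (TP V k) Δ) ∘ₗ (iterDelta Δ (k + 1))

theorem key_aux {V : Type} [AddCommGroup V] [Module ℂ V] (n : ℕ)
    (Δ : V →ₗ[ℂ] V ⊗[ℂ] V)
    (W : ℕ → Submodule ℂ V) (hWtop : ∀ i, n ≤ i → W i = ⊤)
    (hΔW : ∀ i, 1 ≤ i → i ≤ n → ∀ v ∈ W i,
      Δ v ∈ LinearMap.range (TensorProduct.map (W (i - 1)).subtype (W (i - 1)).subtype))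
    (i : ℕ) (f g : Module.Dual ℂ V) (hg : g ∈ (W i).dualAnnihilator) :
    (TensorProduct.dualDistrib ℂ V V (f ⊗ₜ[ℂ] g)) ∘ₗ Δ ∈ (W (i + 1)).dualAnnihilator := by
  rw [Submodule.mem_dualAnnihilator] at hg ⊢
  intro v hv
  rcases Nat.lt_or_ge i n with h | h
  · obtain ⟨t, ht⟩ := hΔW (i + 1) (by omega) h v hv
    rw [LinearMap.comp_apply, ← ht]
    clear ht
    induction t using TensorProduct.induction_on with
    | zero => simp
    | tmul x y =>
      rw [TensorProduct.map_tmul, TensorProduct.dualDistrib_apply]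
      have : g ((W (i + 1 - 1)).subtype y) = 0 := hg _ y.2
      rw [this, mul_zero]
    | add x y hx hy => rw [map_add, map_add, hx, hy, add_zero]
  · have : g = 0 := by
      ext w
      exact hg w (by rw [hWtop i h]; trivial)
    subst this
    simp

theorem prod_aux {V : Type} [AddCommGroup V] [Module ℂ V]
    (Δ : V →ₗ[ℂ] V ⊗[ℂ] V)
    (W : ℕ → Submodule ℂ V) (hW0 : W 0 = ⊥)
    (key : ∀ (i : ℕ) (f g : Module.Dual ℂ V), g ∈ (W i).dualAnnihilator →
      (TensorProduct.dualDistrib ℂ V V (f ⊗ₜ[ℂ] g)) ∘ₗ Δ ∈ (W (i + 1)).dualAnnihilator)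
    (i : ℕ) (g : Fin (i + 1) → ℂ × Module.Dual ℂ V) (h : ∀ j, (g j).1 = 0) :
      ((List.ofFn g).foldr (deltaMul Δ) (1, 0)).1 = 0 ∧
      ((List.ofFn g).foldr (deltaMul Δ) (1, 0)).2 ∈ (W i).dualAnnihilator := by
  induction i with
  | zero => simp [deltaMul, h, hW0]
  | succ i ih =>
    obtain ⟨h1, h2⟩ := ih (fun j => g j.succ) (fun j => h _)
    rw [List.ofFn_succ, List.foldr_cons]
    generalize List.foldr (deltaMul Δ) (1, 0) (List.ofFn fun j => g j.succ) = q at h1 h2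
    refine ⟨by simp [deltaMul, h1], ?_⟩
    simp only [deltaMul, h, h1, zero_smul, zero_add]
    exact key _ _ _ h2

/-- given a filtration `0 = V⁰ ⊆ V¹ ⊆ ⋯ ⊆ Vⁿ = V` with
`Δ(Vⁱ) ⊆ image of V^{i−1} ⊗ V^{i−1}`, the annihilators `m_i = (V^{i−1})^⊥ ⊆ V* = m` satisfy
`m·m_i ⊆ m_{i+1}`, each `m_i` is an ideal of `R_Δ`, and `mⁱ ⊆ m_i`. -/
theorem stmt_4 {V : Type} [AddCommGroup V] [Module ℂ V] [FiniteDimensional ℂ V] (n : ℕ)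
    (Δ : V →ₗ[ℂ] V ⊗[ℂ] V)
    (hcoc : (TensorProduct.comm ℂ V V).toLinearMap ∘ₗ Δ = Δ)
    (hcoa : (TensorProduct.assoc ℂ V V V).toLinearMap ∘ₗ LinearMap.rTensor V Δ ∘ₗ Δ
      = LinearMap.lTensor V Δ ∘ₗ Δ)
    (hnil : iterDelta Δ n = 0)
    (W : ℕ → Submodule ℂ V)
    (hW0 : W 0 = ⊥) (hWtop : ∀ i, n ≤ i → W i = ⊤) (hWmono : Monotone W)
    (hΔW : ∀ i, 1 ≤ i → i ≤ n → ∀ v ∈ W i,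
      Δ v ∈ LinearMap.range (TensorProduct.map (W (i - 1)).subtype (W (i - 1)).subtype)) :
    -- `m · m_i ⊆ m_{i+1}` for `1 ≤ i ≤ n`
    (∀ i, 1 ≤ i → i ≤ n → ∀ f g : Module.Dual ℂ V, g ∈ (W (i - 1)).dualAnnihilator →
      (deltaMul Δ (0, f) (0, g)).2 ∈ (W i).dualAnnihilator) ∧
    -- each `m_i` (`i ≥ 1`) is an ideal of `R_Δ`: it absorbs multiplication by arbitrary
    -- elements of `R_Δ` (it is an additive subgroup, being a subspace)
    (∀ i, 1 ≤ i → ∀ (p : ℂ × Module.Dual ℂ V) (g : Module.Dual ℂ V),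
      g ∈ (W (i - 1)).dualAnnihilator →
      (deltaMul Δ p (0, g)).1 = 0 ∧ (deltaMul Δ p (0, g)).2 ∈ (W (i - 1)).dualAnnihilator) ∧
    -- `mⁱ ⊆ m_i` for `i ≥ 1`: any product of `i` elements of `m` lies in `{0} × m_i`
    (∀ i, 1 ≤ i → ∀ g : Fin i → ℂ × Module.Dual ℂ V, (∀ j, (g j).1 = 0) →
      ((List.ofFn g).foldr (deltaMul Δ) (1, 0)).1 = 0 ∧
      ((List.ofFn g).foldr (deltaMul Δ) (1, 0)).2 ∈ (W (i - 1)).dualAnnihilator) := by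
  have key := key_aux n Δ W hWtop hΔW
  refine ⟨?_, ?_, ?_⟩
  · intro i hi _ f g hg
    obtain ⟨i, rfl⟩ := Nat.exists_eq_add_of_le' hi
    simp only [deltaMul, zero_smul, zero_add]
    exact key i f g hg
  · intro i _ p g hg
    refine ⟨by simp [deltaMul], ?_⟩
    simp only [deltaMul, zero_smul, add_zero]
    exact Submodule.add_mem _ (Submodule.smul_mem _ _ hg)
      (Submodule.dualAnnihilator_anti (hWmono (Nat.le_succ _)) (key _ p.2 g hg))
  · intro i hi g h
    obtain ⟨i, rfl⟩ := Nat.exists_eq_add_of_le' hi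
    exact prod_aux Δ W hW0 key i g h
end

section
/- Let X be a type and n ≥ 1. Consider the equivalence relation on tuples f, g : Fin n → X given by f ∼ g if and only if the ranges of f and g are equal, and let X⟨n⟩ denote the quotient of (Fin n → X) by this relation. Then the map sending a tuple f to the finite set of its values induces a well-defined bijection from X⟨n⟩ onto the set of nonempty finite subsets s of X with cardinality at most n. -/
/-- The equivalence relation on `n`-tuples identifying two tuples exactly when they have the
same underlying set of values; its quotient is the very symmetric product `X⟨n⟩`. -/
def rangeSetoid (X : Type*) (n : ℕ) : Setoid (Fin n → X) :=
  ⟨fun f g => Set.range f = Set.range g, ⟨fun _ => rfl, Eq.symm, Eq.trans⟩⟩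

/-- the map sending a tuple to the set of its values induces a well-defined
bijection from the very symmetric product `X⟨n⟩` onto the nonempty finite subsets of `X` of
cardinality at most `n`. -/
theorem stmt_8 (X : Type*) (n : ℕ) (hn : 1 ≤ n) :
    ∃ e : Quotient (rangeSetoid X n) ≃ {s : Set X // s.Nonempty ∧ s.Finite ∧ s.ncard ≤ n},
      ∀ f : Fin n → X, (e (Quotient.mk (rangeSetoid X n) f) : Set X) = Set.range f := by
  classical
  have hP : ∀ f : Fin n → X, (Set.range f).Nonempty ∧ (Set.range f).Finite ∧
      (Set.range f).ncard ≤ n := by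
    intro f
    refine ⟨⟨f ⟨0, hn⟩, Set.mem_range_self _⟩, Set.finite_range f, ?_⟩
    rw [← Set.image_univ]
    refine (Set.ncard_image_le Set.finite_univ).trans ?_
    simp [Set.ncard_univ]
  let F : Quotient (rangeSetoid X n) → {s : Set X // s.Nonempty ∧ s.Finite ∧ s.ncard ≤ n} :=
    Quotient.lift (fun f => ⟨Set.range f, hP f⟩) (fun _ _ h => Subtype.ext h)
  have hF : Function.Bijective F := by
    constructor
    · intro a b
      induction a using Quotient.inductionOn
      induction b using Quotient.inductionOn
      intro h
      exact Quotient.sound (congrArg Subtype.val h)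
    · rintro ⟨s, hne, hfin, hcard⟩
      have : Fintype s := hfin.fintype
      have : Nonempty s := hne.to_subtype
      have hc : Fintype.card s ≤ Fintype.card (Fin n) := by
        rw [Fintype.card_fin, ← Nat.card_eq_fintype_card]
        exact hcard
      obtain ⟨i⟩ := Function.Embedding.nonempty_of_card_le hc
      have hs : Function.Surjective (Function.invFun i) := Function.invFun_surjective i.injective
      refine ⟨Quotient.mk _ (Subtype.val ∘ Function.invFun i), Subtype.ext ?_⟩
      change Set.range (Subtype.val ∘ Function.invFun i) = s
      rw [hs.range_comp, Subtype.range_coe]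
  exact ⟨Equiv.ofBijective F hF, fun f => rfl⟩
end

section
/- Let X be a Hausdorff topological space and n ≥ 1. Give Xⁿ = (Fin n → X) the product topology and the very symmetric product X⟨n⟩ (the quotient of Xⁿ by the relation 'equal range') the quotient topology. Then: (a) the set N of non-injective tuples f : Fin n → X is closed in Xⁿ; (b) N is saturated for the equivalence relation (if f and g have equal range, then f is injective if and only if g is); and (c) consequently the image of N in X⟨n⟩, i.e. the subset of X⟨n⟩ corresponding to subsets of X of cardinality at most n − 1, is closed in X⟨n⟩. -/
/-- for a Hausdorff space `X`: (a) the set of non-injective `n`-tuples is closed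
in `Xⁿ`; (b) it is saturated for the "equal range" relation; (c) hence its image in the very
symmetric product `X⟨n⟩` is closed in the quotient topology. -/
theorem stmt_9 (X : Type*) [TopologicalSpace X] [T2Space X] (n : ℕ) (hn : 1 ≤ n) :
    IsClosed {f : Fin n → X | ¬ Function.Injective f} ∧
    (∀ f g : Fin n → X, Set.range f = Set.range g →
      (Function.Injective f ↔ Function.Injective g)) ∧
    IsClosed ((fun f : Fin n → X => Quotient.mk (rangeSetoid X n) f) ''
      {f : Fin n → X | ¬ Function.Injective f}) := by
  have ha : IsClosed {f : Fin n → X | ¬ Function.Injective f} := by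
    have h : {f : Fin n → X | ¬ Function.Injective f} =
        ⋃ p ∈ {p : Fin n × Fin n | p.1 ≠ p.2}, {f : Fin n → X | f p.1 = f p.2} := by
      ext f
      simp only [Function.Injective, Set.mem_setOf_eq, Set.mem_iUnion, Prod.exists]
      push Not
      constructor
      · rintro ⟨a, b, h1, h2⟩
        exact ⟨a, b, h2, h1⟩
      · rintro ⟨a, b, h1, h2⟩
        exact ⟨a, b, h2, h1⟩
    rw [h]
    exact (Set.toFinite _).isClosed_biUnion fun p _ =>
      isClosed_eq (continuous_apply _) (continuous_apply _)
  have key : ∀ f g : Fin n → X, Set.range f = Set.range g →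
      Function.Injective f → Function.Injective g := by
    intro f g hfg hf
    have h1 : ∀ i, ∃ j, g j = f i := fun i => by
      have : f i ∈ Set.range g := hfg ▸ Set.mem_range_self i
      exact this
    choose k hk using h1
    have hkinj : Function.Injective k := fun a b hab => hf (by rw [← hk a, ← hk b, hab])
    have hks : Function.Surjective k := Finite.surjective_of_injective hkinj
    intro a b hab
    obtain ⟨a, rfl⟩ := hks a
    obtain ⟨b, rfl⟩ := hks b
    rw [hk, hk] at hab
    rw [hf hab]
  refine ⟨ha, fun f g h => ⟨key f g h, key g f h.symm⟩, ?_⟩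
  have hq : Topology.IsQuotientMap
      (fun f : Fin n → X => Quotient.mk (rangeSetoid X n) f) := isQuotientMap_quotient_mk'
  rw [← hq.isClosed_preimage]
  convert ha using 1
  ext f
  simp only [Set.mem_preimage, Set.mem_image, Set.mem_setOf_eq]
  constructor
  · rintro ⟨g, hg, he⟩ hf
    have hr : Set.range g = Set.range f := Quotient.exact he
    exact hg (key f g hr.symm hf)
  · intro hf
    exact ⟨f, hf, rfl⟩
end

section
/- Let A be an associative unital ℚ-algebra, d : A → A a derivation (additive with d(ab) = d(a)b + a·d(b)), and s ∈ A a nilpotent element. Then exp(−s) · d(exp(s)) = Σ_{k≥0} ((−1)^k/(k+1)!) (ad s)^k (d(s)), where ad s : A → A is the map x ↦ sx − xs; the sum is finite because ad s is nilpotent whenever s is. -/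
/-- The exponential `exp x = Σ_{k≥0} x^k/k!` of a nilpotent element `x`: the series terminates
by nilpotency, so it may be computed as the finite sum over `k < nilpotencyClass x`. -/
noncomputable def nexp {A : Type*} [Ring A] [Algebra ℚ A] (x : A) : A :=
  ∑ k ∈ Finset.range (nilpotencyClass x), ((k.factorial : ℚ))⁻¹ • x ^ k

theorem nexp_eq_isNilpotent_exp {A : Type*} [Ring A] [Algebra ℚ A] (x : A) :
    nexp x = IsNilpotent.exp x := rfl

theorem der_pow {A : Type*} [Ring A] [Algebra ℚ A] (d : A → A)
    (hadd : ∀ x y : A, d (x + y) = d x + d y)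
    (hleib : ∀ x y : A, d (x * y) = d x * y + x * d y) (s : A) (a : ℕ → A)
    (ha0 : a 0 = d s) (ha : ∀ k, a (k + 1) = s * a k - a k * s) (n : ℕ) :
    d (s ^ n) = ∑ k ∈ Finset.range n,
      ((-1 : ℚ) ^ k * (n.choose (k + 1) : ℚ)) • (s ^ (n - 1 - k) * a k) := by
  induction n with
  | zero =>
    have := hleib 1 1
    simpa using this
  | succ n ih =>
    have h1 : ∀ k, k ∈ Finset.range (n + 1) →
        ((-1 : ℚ) ^ k * ((n + 1).choose (k + 1) : ℚ)) • (s ^ (n + 1 - 1 - k) * a k)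
        = ((-1 : ℚ) ^ k * (n.choose k : ℚ)) • (s ^ (n - k) * a k)
          + ((-1 : ℚ) ^ k * (n.choose (k + 1) : ℚ)) • (s ^ (n - k) * a k) := by
      intro k _
      rw [Nat.choose_succ_succ, ← add_smul, Nat.add_sub_cancel]
      push_cast
      rw [mul_add]
    rw [Finset.sum_congr rfl h1, Finset.sum_add_distrib, Finset.sum_range_succ',
      Finset.sum_range_succ (fun k => ((-1 : ℚ) ^ k * (n.choose (k + 1) : ℚ)) • (s ^ (n - k) * a k)),
      pow_succ, hleib, ih, Finset.sum_mul]
    have h2 : ∀ k, k ∈ Finset.range n →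
        (((-1 : ℚ) ^ k * (n.choose (k + 1) : ℚ)) • (s ^ (n - 1 - k) * a k)) * s
        = ((-1 : ℚ) ^ (k + 1) * (n.choose (k + 1) : ℚ)) • (s ^ (n - (k + 1)) * a (k + 1))
          + ((-1 : ℚ) ^ k * (n.choose (k + 1) : ℚ)) • (s ^ (n - k) * a k) := by
      intro k hk
      have hk' := Finset.mem_range.1 hk
      have e1 : n - (k + 1) = n - 1 - k := by omega
      have e2 : n - k = (n - 1 - k) + 1 := by omega
      rw [e1, e2, ha, pow_succ (-1 : ℚ), pow_succ s, mul_neg_one, neg_mul, neg_smul, ← smul_neg,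
        ← smul_add, smul_mul_assoc]
      congr 1
      noncomm_ring
    rw [Finset.sum_congr rfl h2, Finset.sum_add_distrib]
    simp [ha0]
    abel

theorem sum_prod_antidiag {A : Type*} [Ring A] (f g : ℕ → A) (M K : ℕ)
    (hf : ∀ m, M ≤ m → f m = 0) (hg : ∀ k, K ≤ k → g k = 0) :
    ∑ n ∈ Finset.range (M + K), ∑ k ∈ Finset.range (n + 1), f (n - k) * g k
      = (∑ m ∈ Finset.range M, f m) * ∑ k ∈ Finset.range K, g k := by
  rw [Finset.sum_mul_sum, ← Finset.sum_product', Finset.sum_sigma']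
  symm
  apply Finset.sum_bij_ne_zero (fun (p : ℕ × ℕ) _ _ => (⟨p.1 + p.2, p.2⟩ : (_ : ℕ) × ℕ))
  · rintro ⟨m, k⟩ h _
    simp at h ⊢
    omega
  · rintro ⟨m, k⟩ h _ ⟨m', k'⟩ h' _ e
    simp at e
    simp
    omega
  · rintro ⟨n, k⟩ h h0
    simp at h
    refine ⟨(n - k, k), ?_, h0, ?_⟩
    · simp
      constructor
      · by_contra hc
        exact h0 (by simp only [hf (n - k) (by omega), zero_mul])
      · by_contra hc
        exact h0 (by simp only [hg k (by omega), mul_zero])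
    · simp
      omega
  · rintro ⟨m, k⟩ h _
    simp

theorem stmt_17 (A : Type*) [Ring A] [Algebra ℚ A] (d : A → A)
    (hadd : ∀ x y : A, d (x + y) = d x + d y)
    (hleib : ∀ x y : A, d (x * y) = d x * y + x * d y)
    (s : A) (hs : IsNilpotent s) :
    (∃ K, (fun y => s * y - y * s)^[K] (d s) = 0) ∧
    ∀ K, (fun y => s * y - y * s)^[K] (d s) = 0 →
      nexp (-s) * d (nexp s) =
        ∑ k ∈ Finset.range K,
          (((-1 : ℚ)) ^ k * (((k + 1).factorial : ℚ))⁻¹) • (fun y => s * y - y * s)^[k] (d s) := by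
  constructor
  · have h1 : IsNilpotent (LinearMap.mulLeft ℚ s - LinearMap.mulRight ℚ s) := by
      apply Commute.isNilpotent_sub
      · exact LinearMap.ext fun c => (mul_assoc s c s).symm
      · exact (LinearMap.isNilpotent_mulLeft_iff ℚ s).2 hs
      · exact (LinearMap.isNilpotent_mulRight_iff ℚ s).2 hs
    obtain ⟨K, hK⟩ := h1
    refine ⟨K, ?_⟩
    have := congrArg (fun f => f (d s)) hK
    simp only [Module.End.pow_apply] at this
    exact this
  · intro K hK
    set a : ℕ → A := fun k => (fun y => s * y - y * s)^[k] (d s) with hadef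
    have ha0 : a 0 = d s := rfl
    have ha : ∀ k, a (k + 1) = s * a k - a k * s := fun k => by
      simp only [hadef, Function.iterate_succ_apply']
    have haK : ∀ k, K ≤ k → a k = 0 := by
      intro k hk
      induction k, hk using Nat.le_induction with
      | base => exact hK
      | succ k _ ih => rw [ha, ih]; simp
    let D : A →+ A := AddMonoidHom.mk' d hadd
    have hD : ∀ x, d x = D x := fun _ => rfl
    obtain ⟨M, hM⟩ := hs
    have hsM : ∀ m, M ≤ m → s ^ m = 0 := fun m hm => pow_eq_zero_of_le hm hM
    rw [nexp_eq_isNilpotent_exp, nexp_eq_isNilpotent_exp]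
    have key : d (IsNilpotent.exp s) = IsNilpotent.exp s * ∑ k ∈ Finset.range K,
          (((-1 : ℚ)) ^ k * (((k + 1).factorial : ℚ))⁻¹) • a k := by
      nth_rewrite 2 [IsNilpotent.exp_eq_sum hM]
      rw [IsNilpotent.exp_eq_sum (hsM (M + K + 1) (by omega)),
        ← sum_prod_antidiag (fun m => ((m.factorial : ℚ))⁻¹ • s ^ m)
          (fun k => (((-1 : ℚ)) ^ k * (((k + 1).factorial : ℚ))⁻¹) • a k) M K
          (fun m hm => by simp [hsM m hm]) (fun k hk => by simp [haK k hk]),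
        hD, map_sum, Finset.sum_range_succ']
      have z : D (((Nat.factorial 0 : ℚ))⁻¹ • s ^ 0) = 0 := by
        have := hleib 1 1
        rw [← hD]
        simpa using this
      rw [z, add_zero]
      refine Finset.sum_congr rfl fun n _ => ?_
      rw [map_rat_smul, ← hD, der_pow d hadd hleib s a ha0 ha, Finset.smul_sum]
      refine Finset.sum_congr rfl fun k hk => ?_
      have hk' : k ≤ n := by have := Finset.mem_range.1 hk; omega
      rw [smul_mul_smul_comm, smul_smul, Nat.add_sub_cancel]
      congr 1
      rw [Nat.cast_choose ℚ (show k + 1 ≤ n + 1 by omega), Nat.add_sub_add_right]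
      have := Nat.factorial_ne_zero (n + 1)
      have := Nat.factorial_ne_zero (k + 1)
      have := Nat.factorial_ne_zero (n - k)
      field_simp
    rw [key, ← mul_assoc, IsNilpotent.exp_neg_mul_exp_self ⟨M, hM⟩, one_mul]
end

section
/- Let A be an associative unital ℚ-algebra, d : A → A a derivation, and s, t ∈ A nilpotent elements. If d(exp(s) · exp(−t)) = 0, then exp(−s) · d(exp(s)) = exp(−t) · d(exp(t)). -/
/-- the gluing identity: if `d(exp(s)·exp(−t)) = 0` then
`exp(−s)·d(exp s) = exp(−t)·d(exp t)`. -/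
theorem stmt_18 (A : Type*) [Ring A] [Algebra ℚ A] (d : A → A)
    (hadd : ∀ x y : A, d (x + y) = d x + d y)
    (hleib : ∀ x y : A, d (x * y) = d x * y + x * d y)
    (s t : A) (hs : IsNilpotent s) (ht : IsNilpotent t)
    (h : d (nexp s * nexp (-t)) = 0) :
    nexp (-s) * d (nexp s) = nexp (-t) * d (nexp t) := by
  have e : ∀ x : A, nexp x = IsNilpotent.exp x := fun x => rfl
  have h1 : nexp (-s) * nexp s = 1 := by
    rw [e, e]; exact IsNilpotent.exp_neg_mul_exp_self hs
  have h2 : nexp (-t) * nexp t = 1 := by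
    rw [e, e]; exact IsNilpotent.exp_neg_mul_exp_self ht
  have h3 : d (nexp s) = nexp s * nexp (-t) * d (nexp t) := by
    have h4 := hleib (nexp s * nexp (-t)) (nexp t)
    rwa [h, zero_mul, zero_add, mul_assoc, h2, mul_one] at h4
  rw [h3, mul_assoc, ← mul_assoc, h1, one_mul]
end
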